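/- Let τ be a 1-tangle in a graph G. Then for every edge e of G, the tangle τ extends to a 1-tangle τ' in G − e. -/

import Mathlib

open Finset

variable {V : Type} [Fintype V] [DecidableEq V]

/-- `{A, B}` is a separation of the graph `G`: the two sides together cover the vertex set and
no edge of `G` joins `A \ B` to `B \ A`. -/
def IsSep (G : SimpleGraph V) (A B : Finset V) : Prop :=
  A ∪ B = Finset.univ ∧ ∀ a ∈ A \ B, ∀ b ∈ B \ A, ¬ G.Adj a b

/-- `G[A₁] ∪ G[A₂] ∪ G[A₃] = G` for the induced subgraphs on `A₁`, `A₂`, `A₃`. -/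
def CoversG (G : SimpleGraph V) (A₁ A₂ A₃ : Finset V) : Prop :=
  (∀ v : V, v ∈ A₁ ∨ v ∈ A₂ ∨ v ∈ A₃) ∧
    ∀ u v : V, G.Adj u v →
      (u ∈ A₁ ∧ v ∈ A₁) ∨ (u ∈ A₂ ∧ v ∈ A₂) ∨ (u ∈ A₃ ∧ v ∈ A₃)

/-- `τ` is a `k`-tangle in `G`: a set of oriented separations of order `< k` containing exactly
one orientation of every separation of order `< k`, and no three of its elements have small
sides whose induced subgraphs together cover `G`. -/
def IsTangle (G : SimpleGraph V) (k : ℕ) (τ : Set (Finset V × Finset V)) : Prop :=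
  (∀ p ∈ τ, IsSep G p.1 p.2 ∧ (p.1 ∩ p.2).card < k) ∧
    (∀ A B : Finset V, IsSep G A B → (A ∩ B).card < k → ((A, B) ∈ τ ↔ (B, A) ∉ τ)) ∧
    ∀ p₁ ∈ τ, ∀ p₂ ∈ τ, ∀ p₃ ∈ τ, ¬ CoversG G p₁.1 p₂.1 p₃.1

theorem IsSep.symm {G : SimpleGraph V} {A B : Finset V} (h : IsSep G A B) : IsSep G B A :=
  ⟨by rw [Finset.union_comm]; exact h.1, fun a ha b hb hab => h.2 b hb a ha hab.symm⟩

theorem IsSep.mono {G H : SimpleGraph V} (hHG : H ≤ G) {A B : Finset V} (h : IsSep G A B) :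
    IsSep H A B :=
  ⟨h.1, fun a ha b hb hab => h.2 a ha b hb (hHG hab)⟩

theorem IsSep.mem_or_mem {G : SimpleGraph V} {A B : Finset V} (h : IsSep G A B) (v : V) :
    v ∈ A ∨ v ∈ B :=
  Finset.mem_union.1 (h.1 ▸ Finset.mem_univ v)

theorem Finset.card_inter_lt_one_iff {α : Type*} [DecidableEq α] {A B : Finset α} :
    (A ∩ B).card < 1 ↔ ∀ v ∈ A, v ∉ B := by
  rw [Nat.lt_one_iff, Finset.card_eq_zero, ← Finset.disjoint_iff_inter_eq_empty,
    Finset.disjoint_left]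

theorem IsSep.union_inter {G : SimpleGraph V} {A B A' B' : Finset V} (h : IsSep G A B)
    (h' : IsSep G A' B') (hd : ∀ v ∈ A, v ∉ B) (hd' : ∀ v ∈ A', v ∉ B') :
    IsSep G (A ∪ A') (B ∩ B') := by
  refine ⟨?_, ?_⟩
  · ext v
    have := h.mem_or_mem v
    have := h'.mem_or_mem v
    simp only [Finset.mem_union, Finset.mem_inter, Finset.mem_univ, iff_true]
    tauto
  · intro a ha b hb
    simp only [Finset.mem_sdiff, Finset.mem_union, Finset.mem_inter, not_or] at ha hb
    rcases ha.1 with haA | haA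
    · exact h.2 a (Finset.mem_sdiff.2 ⟨haA, hd a haA⟩) b (Finset.mem_sdiff.2 ⟨hb.1.1, hb.2.1⟩)
    · exact h'.2 a (Finset.mem_sdiff.2 ⟨haA, hd' a haA⟩) b (Finset.mem_sdiff.2 ⟨hb.1.2, hb.2.2⟩)

/-- Both ends of an edge lie on the same side of a separation of order `0`. -/
theorem IsSep.mem_of_adj {G : SimpleGraph V} {A B : Finset V} (h : IsSep G A B)
    (hd : ∀ v ∈ A, v ∉ B) {u v : V} (huv : G.Adj u v) (hu : u ∈ A) : v ∈ A := by
  by_contra hv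
  exact h.2 u (Finset.mem_sdiff.2 ⟨hu, hd u hu⟩) v
    (Finset.mem_sdiff.2 ⟨(h.mem_or_mem v).resolve_left hv, hv⟩) huv

/-- The small sides of a `1`-tangle cannot cover the vertex set. -/
theorem IsTangle.not_forall_mem_fst {G : SimpleGraph V} {τ : Set (Finset V × Finset V)}
    (hτ : IsTangle G 1 τ) {p₁ p₂ p₃ : Finset V × Finset V} (h₁ : p₁ ∈ τ) (h₂ : p₂ ∈ τ)
    (h₃ : p₃ ∈ τ) : ¬ ∀ v, v ∈ p₁.1 ∨ v ∈ p₂.1 ∨ v ∈ p₃.1 := by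
  have key : ∀ p ∈ τ, ∀ u v, G.Adj u v → u ∈ p.1 → v ∈ p.1 := fun p hp u v huv hu =>
    (hτ.1 p hp).1.mem_of_adj (Finset.card_inter_lt_one_iff.1 (hτ.1 p hp).2) huv hu
  refine fun hv => hτ.2.2 p₁ h₁ p₂ h₂ p₃ h₃ ⟨hv, fun u v huv => ?_⟩
  have k₁ := key p₁ h₁ u v huv
  have k₂ := key p₂ h₂ u v huv
  have k₃ := key p₃ h₃ u v huv
  have := hv u
  tauto

theorem IsTangle.nonempty {G : SimpleGraph V} {k : ℕ} {τ : Set (Finset V × Finset V)}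
    (hk : 0 < k) (hτ : IsTangle G k τ) : τ.Nonempty := by
  by_cases h : ((∅ : Finset V), (Finset.univ : Finset V)) ∈ τ
  · exact ⟨_, h⟩
  · refine ⟨(Finset.univ, ∅), (hτ.2.1 _ _ ⟨by simp, by simp⟩ (by simpa using hk)).2 h⟩

/-- A `1`-tangle points towards some vertex. -/
theorem IsTangle.exists_forall_mem_snd {G : SimpleGraph V} {τ : Set (Finset V × Finset V)}
    (hτ : IsTangle G 1 τ) : ∃ v, ∀ p ∈ τ, v ∈ p.2 := by
  obtain ⟨p, hp, hmax⟩ := Set.exists_max_image τ (fun p => p.1.card) τ.toFinite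
    (hτ.nonempty one_pos)
  have hdp := Finset.card_inter_lt_one_iff.1 (hτ.1 p hp).2
  obtain ⟨v, hv⟩ : ∃ v, v ∉ p.1 := by
    by_contra! h
    exact hτ.not_forall_mem_fst hp hp hp fun v => Or.inl (h v)
  refine ⟨v, fun q hq => ?_⟩
  by_contra hvq
  have hdq := Finset.card_inter_lt_one_iff.1 (hτ.1 q hq).2
  have hvq' := ((hτ.1 q hq).1.mem_or_mem v).resolve_right hvq
  have hsep := (hτ.1 p hp).1.union_inter (hτ.1 q hq).1 hdp hdq
  have hdisj : ((p.1 ∪ q.1) ∩ (p.2 ∩ q.2)).card < 1 := by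
    refine Finset.card_inter_lt_one_iff.2 fun w hw hw' => ?_
    rw [Finset.mem_inter] at hw'
    exact (Finset.mem_union.1 hw).elim (fun h => hdp w h hw'.1) (fun h => hdq w h hw'.2)
  by_cases hmem : (p.1 ∪ q.1, p.2 ∩ q.2) ∈ τ
  · refine (hmax _ hmem).not_gt (Finset.card_lt_card ?_)
    exact Finset.ssubset_iff_subset_ne.2 ⟨Finset.subset_union_left, fun h =>
      hv (h ▸ Finset.mem_union_right _ hvq')⟩
  · have hflip : (p.2 ∩ q.2, p.1 ∪ q.1) ∈ τ := by
      by_contra h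
      exact hmem ((hτ.2.1 _ _ hsep hdisj).2 h)
    refine hτ.not_forall_mem_fst hp hq hflip fun w => ?_
    simpa [or_assoc] using hsep.mem_or_mem w

/-- The separations of order `0` oriented towards a fixed vertex form a `1`-tangle. -/
theorem isTangle_one_of_vertex (G : SimpleGraph V) (v : V) :
    IsTangle G 1 {p | (IsSep G p.1 p.2 ∧ (p.1 ∩ p.2).card < 1) ∧ v ∈ p.2} := by
  refine ⟨fun p hp => hp.1, fun A B h hd => ?_, fun p₁ h₁ p₂ h₂ p₃ h₃ hc => ?_⟩
  · have hd' : (B ∩ A).card < 1 := by rwa [Finset.inter_comm]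
    have hdv := Finset.card_inter_lt_one_iff.1 hd v
    have := h.mem_or_mem v
    have := h.symm
    simp only [Set.mem_ofPred_eq]
    tauto
  · have key : ∀ p : Finset V × Finset V, (p.1 ∩ p.2).card < 1 → v ∈ p.2 → v ∉ p.1 :=
      fun p hp hv hv' => Finset.card_inter_lt_one_iff.1 hp v hv' hv
    rcases hc.1 v with h | h | h
    · exact key p₁ h₁.1.2 h₁.2 h
    · exact key p₂ h₂.1.2 h₂.2 h
    · exact key p₃ h₃.1.2 h₃.2 h

/-- Every 1-tangle in a graph `G` extends to a 1-tangle in `G - e` for every edge `e` of `G`. -/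
theorem stmt5 (G : SimpleGraph V) (τ : Set (Finset V × Finset V)) (hτ : IsTangle G 1 τ)
    (e : Sym2 V) (he : e ∈ G.edgeSet) :
    ∃ τ' : Set (Finset V × Finset V), IsTangle (G.deleteEdges {e}) 1 τ' ∧ τ ⊆ τ' := by
  obtain ⟨v, hv⟩ := hτ.exists_forall_mem_snd
  exact ⟨_, isTangle_one_of_vertex (G.deleteEdges {e}) v, fun p hp =>
    ⟨⟨(hτ.1 p hp).1.mono (G.deleteEdges_le {e}), (hτ.1 p hp).2⟩, hv p hp⟩⟩
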